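/- Fix n ≥ 1, 0 ≤ s ≤ r ≤ n, and nonzero complex numbers x₁, x₂, a, b₂ with a^m ≠ 1 for 1 ≤ m ≤ n, x₂ ≠ x₁ a^m for |m| ≤ n, b₂ a^m ≠ 1 for 0 ≤ m ≤ n, and b₂ x₁ a^m ≠ x₂ for 0 ≤ m ≤ n. Then the alternating sums at the point ξ = ξ_r satisfy 𝒜(φ_s·D_a)(ξ) = a^{−(r−s)(n−r)} · [(a;a)_{n−s} / ((a;a)_{r−s}·(a;a)_{n−r})] · [(b₂ a^{s};a)_{r−s} / ((x₂/x₁) a^{r+s−n};a)_{r−s}] · 𝒜(φ_r·D_a)(ξ). (This is the off-diagonal/diagonal ratio c⁺_{A,rs}/c⁺_{A,rr} of Proposition 3.1, which is independent of q.) -/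

import Mathlib

open Finset

/-- The q-Pochhammer symbol `(x;c)_m = ∏_{i=0}^{m-1} (1 - c^i x)`. -/
noncomputable def qPoch (x c : ℂ) (m : ℕ) : ℂ := ∏ i ∈ Finset.range m, (1 - c ^ i * x)

/-- The characteristic point `ξ = ξ_r ∈ ℂⁿ`: `ξ_i = x₁ a^{i−1}` for `1 ≤ i ≤ n−r` and
`ξ_{n−r+i} = x₂ a^{i−1}` for `1 ≤ i ≤ r` (here indexed by `Fin n`, zero-based). -/
noncomputable def xiPt (n r : ℕ) (x₁ x₂ a : ℂ) (i : Fin n) : ℂ :=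
  if (i : ℕ) < n - r then x₁ * a ^ (i : ℕ) else x₂ * a ^ ((i : ℕ) - (n - r))

/-- `φ_s(t₁,…,t_n) = ∏_{k=1}^{n−s}(1 − b₂ t_k/x₂) · ∏_{k=n−s+1}^{n}(1 − t_k/x₁)`. -/
noncomputable def phiFun (n s : ℕ) (x₁ x₂ b₂ : ℂ) (t : Fin n → ℂ) : ℂ :=
  (∏ i ∈ Finset.univ.filter (fun i : Fin n => (i : ℕ) < n - s), (1 - b₂ * t i / x₂)) *
    ∏ i ∈ Finset.univ.filter (fun i : Fin n => n - s ≤ (i : ℕ)), (1 - t i / x₁)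

/-- The alternating sum `𝒜(φ_s·D_a)(ξ_r)`. -/
noncomputable def Asum (n r s : ℕ) (x₁ x₂ a b₂ : ℂ) : ℂ :=
  ∑ σ : Equiv.Perm (Fin n),
    ((Equiv.Perm.sign σ : ℤ) : ℂ) *
      phiFun n s x₁ x₂ b₂ (fun i => xiPt n r x₁ x₂ a (σ i)) *
      ∏ p ∈ Finset.univ.filter (fun p : Fin n × Fin n => p.1 < p.2),
        (xiPt n r x₁ x₂ a (σ p.1) - a⁻¹ * xiPt n r x₁ x₂ a (σ p.2))


/-- Generic alternating sum with position weights `w`. -/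
noncomputable def GA (n : ℕ) (w : Fin n → ℂ → ℂ) (c : ℂ) (t : Fin n → ℂ) : ℂ :=
  ∑ σ : Equiv.Perm (Fin n), ((Equiv.Perm.sign σ : ℤ) : ℂ) * (∏ i, w i (t (σ i))) *
    ∏ i, ∏ j ∈ Finset.Ioi i, (t (σ j) - c * t (σ i))

/-- The Vandermonde product. -/
noncomputable def VP (n : ℕ) (t : Fin n → ℂ) : ℂ := ∏ i, ∏ j ∈ Finset.Ioi i, (t j - t i)

lemma permMap_bij (n : ℕ) : Function.Bijective
    (fun p : Fin (n+1) × Equiv.Perm (Fin n) =>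
      (Fin.cycleRange p.1).symm * Equiv.Perm.decomposeFin.symm (0, p.2)) := by
  rw [Fintype.bijective_iff_injective_and_card]
  constructor
  · rintro ⟨k, e⟩ ⟨k', e'⟩ h
    simp only at h
    have h0 := congrArg (fun σ : Equiv.Perm (Fin (n+1)) => σ 0) h
    simp at h0
    subst h0
    have := mul_left_cancel h
    have := Equiv.Perm.decomposeFin.symm.injective this
    simpa using this
  · exact (Fintype.card_congr Equiv.Perm.decomposeFin).symm

lemma GA_expand (n : ℕ) (w : Fin (n+1) → ℂ → ℂ) (c : ℂ) (t : Fin (n+1) → ℂ) :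
    GA (n+1) w c t = ∑ k : Fin (n+1), (-1) ^ (k : ℕ) * w 0 (t k) *
      (∏ i, (t (k.succAbove i) - c * t k)) *
      GA n (fun i => w i.succ) c (fun i => t (k.succAbove i)) := by
  unfold GA
  rw [← (permMap_bij n).sum_comp, Fintype.sum_prod_type]
  refine Finset.sum_congr rfl fun k _ => ?_
  rw [Finset.mul_sum]
  refine Finset.sum_congr rfl fun e _ => ?_
  have hs : Equiv.Perm.sign (Equiv.symm (Fin.cycleRange k)) = (-1) ^ (k : ℕ) := by
    rw [Equiv.Perm.sign_symm, Fin.sign_cycleRange]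
  simp only [Fin.prod_univ_succ (n := n), Fin.prod_Ioi_zero, Fin.prod_Ioi_succ, Equiv.Perm.mul_apply,
    Equiv.Perm.decomposeFin_symm_apply_zero, Equiv.Perm.decomposeFin_symm_apply_succ,
    Equiv.swap_self, Equiv.refl_apply, Fin.cycleRange_symm_zero, Fin.cycleRange_symm_succ,
    Equiv.Perm.sign_mul, hs, Equiv.Perm.decomposeFin.symm_sign]
  rw [Equiv.prod_comp e (fun i => t (k.succAbove i) - c * t k)]
  push_cast
  simp only [one_mul]
  ring

lemma VP_expand (n : ℕ) (t : Fin (n+1) → ℂ) (k : Fin (n+1)) :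
    VP (n+1) t = (-1) ^ (k : ℕ) * (∏ i, (t (k.succAbove i) - t k)) *
      VP n (fun i => t (k.succAbove i)) := by
  have h1 : VP (n+1) (t ∘ (Fin.cycleRange k).symm) = (-1) ^ (k : ℕ) * VP (n+1) t := by
    unfold VP
    rw [← Matrix.det_vandermonde, ← Matrix.det_vandermonde]
    have := Matrix.det_permute (Fin.cycleRange k).symm (Matrix.vandermonde t)
    rw [Equiv.Perm.sign_symm, Fin.sign_cycleRange] at this
    push_cast at this
    rw [← this]
    rfl
  have h2 : VP (n+1) (t ∘ (Fin.cycleRange k).symm) = (∏ i, (t (k.succAbove i) - t k)) *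
      VP n (fun i => t (k.succAbove i)) := by
    unfold VP
    simp only [Fin.prod_univ_succ (n := n), Fin.prod_Ioi_zero, Fin.prod_Ioi_succ,
      Function.comp, Fin.cycleRange_symm_zero, Fin.cycleRange_symm_succ]
  rw [mul_assoc, ← h2, h1, ← mul_assoc, ← pow_add, Even.neg_one_pow ⟨_, rfl⟩, one_mul]

lemma prod_erase_succAbove (n : ℕ) (k : Fin (n+1)) (f : Fin (n+1) → ℂ) :
    ∏ j ∈ Finset.univ.erase k, f j = ∏ i, f (k.succAbove i) := by
  rw [Fin.univ_succAbove n k, Finset.erase_cons, Finset.prod_map]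
  rfl

lemma lagr (m : ℕ) (c : ℂ) (t : Fin (m+1) → ℂ) (ht : Function.Injective t)
    (h0 : ∀ i, t i ≠ 0) :
    (1 - c) * ∑ k : Fin (m+1), ∏ i, ((t (k.succAbove i) - c * t k) / (t (k.succAbove i) - t k))
      = 1 - c ^ (m+1) := by
  set P : Polynomial ℂ := ∏ i, (Polynomial.C (t i) - Polynomial.C c * Polynomial.X) with hP
  have hd : ∀ i ∈ (Finset.univ : Finset (Fin (m+1))),
      (Polynomial.C (t i) - Polynomial.C c * Polynomial.X).natDegree ≤ 1 := by
    intro i _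
    compute_degree
  have hdeg : P.natDegree ≤ m + 1 := by
    refine (Polynomial.natDegree_prod_le _ _).trans ?_
    refine (Finset.sum_le_sum hd).trans ?_
    simp
  have hcoef : P.coeff (m+1) = (-c) ^ (m+1) := by
    have := Polynomial.coeff_prod_of_natDegree_le Finset.univ
      (fun i : Fin (m+1) => (Polynomial.C (t i) - Polynomial.C c * Polynomial.X)) 1 hd
    simpa [hP, Polynomial.coeff_C] using this
  have hinj : Function.Injective (Fin.cons 0 t : Fin (m+2) → ℂ) := by
    rw [Fin.cons_injective_iff]
    refine ⟨?_, ht⟩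
    rintro ⟨i, hi⟩
    exact h0 i hi
  have key := Lagrange.coeff_eq_sum (s := (Finset.univ : Finset (Fin (m+2))))
    (v := (Fin.cons 0 t : Fin (m+2) → ℂ)) hinj.injOn (P := P) (by
      rw [Finset.card_fin]
      refine lt_of_le_of_lt Polynomial.degree_le_natDegree ?_
      exact_mod_cast Nat.lt_succ_of_le hdeg)
  rw [Finset.card_fin, show m + 2 - 1 = m + 1 by omega, hcoef, Fin.sum_univ_succ] at key
  simp only [prod_erase_succAbove] at key
  have hev : ∀ z, P.eval z = ∏ i, (t i - c * z) := by
    intro z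
    simp [hP, Polynomial.eval_prod]
  simp only [Fin.cons_zero, Fin.cons_succ, Fin.succAbove_zero, hev, mul_zero, sub_zero] at key
  have e0 : (∏ i, t i) / ∏ i, ((0:ℂ) - t i) = (-1) ^ (m+1) := by
    rw [← Finset.prod_div_distrib]
    rw [Finset.prod_congr rfl (g := fun _ => (-1:ℂ))]
    · simp
    · intro i _
      have := h0 i
      field_simp
      ring
  have ek : ∀ k : Fin (m+1), (∏ i, (t i - c * t k)) / ∏ i, (t k -
      (Fin.cons 0 t : Fin (m+2) → ℂ) (k.succ.succAbove i)) = (-1) ^ m * ((1 - c) *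
      ∏ i, ((t (k.succAbove i) - c * t k) / (t (k.succAbove i) - t k))) := by
    intro k
    rw [Fin.prod_univ_succAbove _ k, Fin.prod_univ_succ]
    simp only [Fin.succ_succAbove_zero, Fin.succ_succAbove_succ, Fin.cons_zero, Fin.cons_succ]
    have hA : ∏ i, (t k - t (k.succAbove i)) = (-1) ^ m * ∏ i, (t (k.succAbove i) - t k) := by
      rw [← Fin.prod_const, ← Finset.prod_mul_distrib]
      refine Finset.prod_congr rfl fun i _ => by ring
    rw [hA, Finset.prod_div_distrib]
    have h1 := h0 k
    have h2 : ∏ i, (t (k.succAbove i) - t k) ≠ 0 := by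
      rw [Finset.prod_ne_zero_iff]
      intro i _ h
      exact Fin.succAbove_ne k i (ht (sub_eq_zero.mp h))
    have h3 : ((-1:ℂ)^m) * (-1)^m = 1 := by
      rw [← pow_add, Even.neg_one_pow ⟨_, rfl⟩]
    have h4 : ((-1:ℂ)^m) ≠ 0 := by simp
    rw [sub_zero, div_eq_iff (by positivity)]
    generalize ∏ i, (t (k.succAbove i) - c * t k) = Q
    field_simp
    linear_combination (-(1 - c) * Q) * h3
  simp only [ek] at key
  rw [e0, ← Finset.mul_sum, ← Finset.mul_sum, neg_pow] at key
  have h3 : ((-1:ℂ)^m) * (-1)^m = 1 := by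
    rw [← pow_add, Even.neg_one_pow ⟨_, rfl⟩]
  rw [pow_succ (-1:ℂ) m] at key
  linear_combination (-(-1)^m) * key + (1 - c^(m+1) - (1 - c) * ∑ k : Fin (m+1), ∏ i, ((t (k.succAbove i) - c * t k) / (t (k.succAbove i) - t k))) * h3

lemma GA_const (c : ℂ) (f : ℂ → ℂ) : ∀ (n : ℕ) (t : Fin n → ℂ), Function.Injective t →
    (∀ i, t i ≠ 0) →
    (1 - c) ^ n * GA n (fun _ => f) c t =
      (∏ i, f (t i)) * (∏ i ∈ Finset.range n, (1 - c ^ (i+1))) * VP n t := by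
  intro n
  induction n with
  | zero => intro t _ _; simp [GA, VP]
  | succ m ih =>
    intro t ht h0
    rw [GA_expand, Finset.prod_range_succ, ← lagr m c t ht h0, Finset.mul_sum, Finset.mul_sum,
      Finset.mul_sum, Finset.mul_sum, Finset.sum_mul]
    refine Finset.sum_congr rfl fun k _ => ?_
    have ihk := ih (fun i => t (k.succAbove i)) (ht.comp Fin.succAbove_right_injective)
      (fun i => h0 _)
    have h2 : ∏ i, (t (k.succAbove i) - t k) ≠ 0 := by
      rw [Finset.prod_ne_zero_iff]
      intro i _ h
      exact Fin.succAbove_ne k i (ht (sub_eq_zero.mp h))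
    rw [VP_expand m t k, Fin.prod_univ_succAbove _ k, Finset.prod_div_distrib]
    rw [show ∀ A B C D : ℂ, (1 - c) ^ (m+1) * (A * B * C * D) = (1 - c) * A * B * C *
      ((1-c)^m * D) by intros; ring, ihk]
    field_simp

/-- Position weights: the first `s` positions get `g`, the others `f`. -/
noncomputable def WW (n s : ℕ) (f g : ℂ → ℂ) (i : Fin n) : ℂ → ℂ :=
  if (i : ℕ) < s then g else f

lemma xi_succAbove (p r : ℕ) (x₁ x₂ a : ℂ) (hk : p < p + r + 1) (i : Fin (p + r)) :
    xiPt (p + r + 1) (r + 1) x₁ x₂ a (Fin.succAbove ⟨p, hk⟩ i) = xiPt (p + r) r x₁ (x₂ * a) a i := by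
  unfold xiPt
  by_cases h : (i : ℕ) < p
  · rw [Fin.succAbove_of_castSucc_lt _ _ (by simpa [Fin.lt_def] using h)]
    have h1 : (i : ℕ) < p + r + 1 - (r + 1) := by omega
    have h2 : (i : ℕ) < p + r - r := by omega
    simp [h]
  · rw [Fin.succAbove_of_le_castSucc _ _ (by simpa [Fin.le_def] using h)]
    rw [if_neg (by simp; omega), if_neg (by simp; omega)]
    rw [Fin.val_succ, show (i : ℕ) + 1 - (p + r + 1 - (r + 1)) = ((i : ℕ) - (p + r - r)) + 1 by omega]
    ring

lemma xi_at (p r : ℕ) (x₁ x₂ a : ℂ) (hk : p < p + r + 1) :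
    xiPt (p + r + 1) (r + 1) x₁ x₂ a ⟨p, hk⟩ = x₂ := by
  simp [xiPt]

lemma peel (p r s : ℕ) (x₁ x₂ a : ℂ) (ha : a ≠ 0) (f g : ℂ → ℂ) (hg : g x₁ = 0) :
    GA (p + r + 1) (WW _ (s + 1) f g) a⁻¹ (xiPt (p + r + 1) (r + 1) x₁ x₂ a) =
      (-1) ^ p * g x₂ * (∏ i, (xiPt (p + r) r x₁ (x₂ * a) a i - a⁻¹ * x₂)) *
      GA (p + r) (WW _ s f g) a⁻¹ (xiPt (p + r) r x₁ (x₂ * a) a) := by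
  rw [GA_expand, Finset.sum_eq_single (⟨p, by omega⟩ : Fin (p + r + 1))]
  · simp only [xi_succAbove, xi_at]
    have : (fun i : Fin (p + r) => WW (p + r + 1) (s + 1) f g i.succ) = WW (p + r) s f g := by
      funext i
      simp [WW]
    rw [this]
    simp [WW]
  · intro k _ hk
    have hk' : (k : ℕ) ≠ p := fun h => hk (Fin.ext h)
    by_cases h0 : (k : ℕ) = 0
    · have : xiPt (p + r + 1) (r + 1) x₁ x₂ a k = x₁ := by
        unfold xiPt
        rw [if_pos (by omega), h0]
        simp
      rw [this]
      simp [WW, hg]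
    · have hlt := k.isLt
      obtain ⟨i, hi⟩ := Fin.exists_succAbove_eq (y := k) (x := (⟨(k : ℕ) - 1, by omega⟩ : Fin (p + r + 1)))
        (by intro h; have := congrArg Fin.val h; simp at this; omega)
      have hz : xiPt (p + r + 1) (r + 1) x₁ x₂ a (k.succAbove i) -
          a⁻¹ * xiPt (p + r + 1) (r + 1) x₁ x₂ a k = 0 := by
        rw [hi]
        unfold xiPt
        simp only
        by_cases hlt : (k : ℕ) < p
        · rw [if_pos (by omega), if_pos (by omega)]
          obtain ⟨v, hv⟩ : ∃ v, (k : ℕ) = v + 1 := ⟨k - 1, by omega⟩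
          rw [hv, pow_succ]
          field_simp
          simp
        · rw [if_neg (by omega), if_neg (by omega)]
          obtain ⟨v, hv⟩ : ∃ v, (k : ℕ) = p + v + 1 := ⟨k - 1 - p, by omega⟩
          rw [hv, show p + v + 1 - 1 - (p + r + 1 - (r + 1)) = v by omega,
            show p + v + 1 - (p + r + 1 - (r + 1)) = v + 1 by omega, pow_succ]
          field_simp
          simp
      rw [Finset.prod_eq_zero (Finset.mem_univ i) hz]
      simp
  · simp

lemma pow_inj_aux (n : ℕ) (a : ℂ) (ha : a ≠ 0) (ha1 : ∀ m : ℕ, 1 ≤ m → m ≤ n → a ^ m ≠ 1)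
    (i j : ℕ) (hij : i < j) (hj : j ≤ n) : a ^ i ≠ a ^ j := by
  intro h
  obtain ⟨d, rfl⟩ := Nat.exists_eq_add_of_lt hij
  apply ha1 (d + 1) (by omega) (by omega)
  have : a ^ i * a ^ (d + 1) = a ^ i * 1 := by rw [← pow_add, mul_one, h]; congr 1
  exact mul_left_cancel₀ (pow_ne_zero _ ha) this

lemma xi_ne (n r : ℕ) (x₁ x₂ a : ℂ) (hx₁ : x₁ ≠ 0) (hx₂ : x₂ ≠ 0) (ha : a ≠ 0) (i : Fin n) :
    xiPt n r x₁ x₂ a i ≠ 0 := by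
  unfold xiPt
  split_ifs <;> positivity

lemma xi_inj (n r : ℕ) (x₁ x₂ a : ℂ) (hx₁ : x₁ ≠ 0) (hx₂ : x₂ ≠ 0) (ha : a ≠ 0)
    (ha1 : ∀ m : ℕ, 1 ≤ m → m ≤ n → a ^ m ≠ 1)
    (hgen : ∀ m : ℤ, |m| ≤ (n : ℤ) → x₂ ≠ x₁ * a ^ m) :
    Function.Injective (xiPt n r x₁ x₂ a) := by
  have key : ∀ i j : Fin n, i < j → xiPt n r x₁ x₂ a i ≠ xiPt n r x₁ x₂ a j := by
    intro i j hij
    have hij' : (i : ℕ) < j := hij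
    have hj := j.isLt
    unfold xiPt
    by_cases h1 : (j : ℕ) < n - r
    · rw [if_pos h1, if_pos (by omega)]
      intro h
      exact pow_inj_aux n a ha ha1 i j hij' hj.le (mul_left_cancel₀ hx₁ h)
    · rw [if_neg h1]
      by_cases h2 : (i : ℕ) < n - r
      · rw [if_pos h2]
        intro h
        apply hgen ((i : ℕ) - ((j - (n - r) : ℕ) : ℤ)) (by rw [abs_le]; omega)
        rw [zpow_sub₀ ha, zpow_natCast, zpow_natCast]
        field_simp
        exact h.symm
      · rw [if_neg h2]
        intro h
        exact pow_inj_aux n a ha ha1 _ _ (by omega) (by omega) (mul_left_cancel₀ hx₂ h)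
  intro i j h
  rcases lt_trichotomy i j with h' | h' | h'
  · exact absurd h (key _ _ h')
  · exact h'
  · exact absurd h.symm (key _ _ h')

lemma WW_zero (n : ℕ) (f g : ℂ → ℂ) : WW n 0 f g = fun _ => f := by
  funext i
  simp [WW]

lemma peel0 (p r : ℕ) (x₁ x₂ a : ℂ) (hx₁ : x₁ ≠ 0) (hx₂ : x₂ ≠ 0) (ha : a ≠ 0) (f g : ℂ → ℂ)
    (ha1 : ∀ m : ℕ, 1 ≤ m → m ≤ p + r + 1 → a ^ m ≠ 1)
    (hgen : ∀ m : ℤ, |m| ≤ ((p + r + 1 : ℕ) : ℤ) → x₂ ≠ x₁ * a ^ m) :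
    (1 - a⁻¹) * GA (p + r + 1) (WW _ 0 f g) a⁻¹ (xiPt (p + r + 1) (r + 1) x₁ x₂ a) =
      (1 - a⁻¹ ^ (p + r + 1)) *
      ((-1) ^ p * f x₂ * (∏ i, (xiPt (p + r) r x₁ (x₂ * a) a i - x₂)) *
      GA (p + r) (WW _ 0 f g) a⁻¹ (xiPt (p + r) r x₁ (x₂ * a) a)) := by
  have h1 : (1 - a⁻¹) ≠ 0 := by
    intro h
    have := ha1 1 le_rfl (by omega)
    apply this
    field_simp at h
    linear_combination h
  have inj := xi_inj (p + r + 1) (r + 1) x₁ x₂ a hx₁ hx₂ ha ha1 hgen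
  have hk : p < p + r + 1 := by omega
  have ee : (fun i => xiPt (p + r + 1) (r + 1) x₁ x₂ a (Fin.succAbove ⟨p, hk⟩ i)) =
      xiPt (p + r) r x₁ (x₂ * a) a := funext fun i => xi_succAbove ..
  have inj' : Function.Injective (xiPt (p + r) r x₁ (x₂ * a) a) := by
    rw [← ee]
    exact inj.comp Fin.succAbove_right_injective
  have A := GA_const a⁻¹ f _ _ inj (xi_ne _ _ _ _ _ hx₁ hx₂ ha)
  have B := GA_const a⁻¹ f _ _ inj' (xi_ne _ _ _ _ _ hx₁ (mul_ne_zero hx₂ ha) ha)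
  rw [VP_expand _ _ ⟨p, hk⟩, ee, Fin.prod_univ_succAbove _ ⟨p, hk⟩] at A
  simp only [xi_succAbove, xi_at] at A
  rw [Finset.prod_range_succ] at A
  rw [WW_zero, WW_zero]
  apply mul_left_cancel₀ (pow_ne_zero (p + r) h1)
  linear_combination A - (1 - a⁻¹ ^ (p + r + 1)) *
      ((-1) ^ p * f x₂ * (∏ i, (xiPt (p + r) r x₁ (x₂ * a) a i - x₂))) * B

lemma tele1 (p : ℕ) (x₁ x₂ a : ℂ) (ha : a ≠ 0) :
    (∏ i ∈ Finset.range p, (x₁ * a ^ i - x₂)) * (x₁ * a ^ p - x₂) =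
      a ^ p * (x₁ - x₂) * ∏ i ∈ Finset.range p, (x₁ * a ^ i - a⁻¹ * x₂) := by
  induction p with
  | zero => simp
  | succ p ih =>
    rw [Finset.prod_range_succ, Finset.prod_range_succ, ih]
    field_simp
    ring

lemma tele (p r : ℕ) (x₁ x₂ a : ℂ) (ha : a ≠ 0) (hx₂ : x₂ ≠ 0) :
    (∏ i, (xiPt (p + r) r x₁ (x₂ * a) a i - x₂)) * ((a ^ (r + 1) - 1) * (x₁ * a ^ p - x₂)) =
    a ^ (p + r) * (a - 1) * (x₁ - x₂) * ∏ i, (xiPt (p + r) r x₁ (x₂ * a) a i - a⁻¹ * x₂) := by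
  have hs : ∀ y : ℂ, ∏ i, (xiPt (p + r) r x₁ (x₂ * a) a i - y) =
      (∏ i ∈ Finset.range p, (x₁ * a ^ i - y)) * ∏ i ∈ Finset.range r, (x₂ * a * a ^ i - y) := by
    intro y
    rw [Fin.prod_univ_add, Finset.prod_range, Finset.prod_range]
    simp [xiPt]
  rw [hs, hs]
  have h1 := tele1 p x₁ x₂ a ha
  have h2 := tele1 r (x₂ * a) x₂ a ha
  apply mul_left_cancel₀ hx₂
  linear_combination (x₂ * a * a ^ r - x₂) * (∏ i ∈ Finset.range r, (x₂ * a * a ^ i - x₂)) * h1 +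
    a ^ p * (x₁ - x₂) * (∏ i ∈ Finset.range p, (x₁ * a ^ i - a⁻¹ * x₂)) * h2

lemma Asum_eq (n r s : ℕ) (hs : s ≤ n) (x₁ x₂ a b₂ : ℂ) :
    Asum n r s x₁ x₂ a b₂ = ((Equiv.Perm.sign (Fin.revPerm : Equiv.Perm (Fin n)) : ℤ) : ℂ) *
      GA n (WW n s (fun t => 1 - b₂ * t / x₂) (fun t => 1 - t / x₁)) a⁻¹
        (xiPt n r x₁ x₂ a) := by
  unfold Asum GA
  rw [← Equiv.sum_comp (Equiv.mulRight (Fin.revPerm : Equiv.Perm (Fin n))), Finset.mul_sum]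
  refine Finset.sum_congr rfl fun σ _ => ?_
  generalize xiPt n r x₁ x₂ a = ξ
  simp only [Equiv.coe_mulRight, Equiv.Perm.sign_mul, Equiv.Perm.mul_apply, Fin.revPerm_apply]
  have h1 : phiFun n s x₁ x₂ b₂ (fun i => ξ (σ i.rev)) =
      ∏ i, WW n s (fun t => 1 - b₂ * t / x₂) (fun t => 1 - t / x₁) i (ξ (σ i)) := by
    unfold phiFun
    rw [Finset.prod_filter, Finset.prod_filter, ← Finset.prod_mul_distrib,
      ← Equiv.prod_comp (Fin.revPerm : Equiv.Perm (Fin n))]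
    refine Finset.prod_congr rfl fun i _ => ?_
    have hi := i.isLt
    simp only [Fin.revPerm_apply, Fin.rev_rev, Fin.val_rev, WW]
    by_cases h : (i : ℕ) < s
    · rw [if_neg (by omega), if_pos (by omega), if_pos h, one_mul]
    · rw [if_pos (by omega), if_neg (by omega), if_neg h, mul_one]
  have h2 : ∏ p ∈ Finset.univ.filter (fun p : Fin n × Fin n => p.1 < p.2),
        (ξ (σ p.1.rev) - a⁻¹ * ξ (σ p.2.rev)) =
      ∏ i, ∏ j ∈ Finset.Ioi i, (ξ (σ j) - a⁻¹ * ξ (σ i)) := by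
    rw [Finset.prod_sigma']
    refine Finset.prod_nbij' (fun p => ⟨p.2.rev, p.1.rev⟩) (fun q => (q.2.rev, q.1.rev)) ?_ ?_ ?_ ?_ ?_
    · intro p hp
      simpa using hp
    · intro p hp
      simpa using hp
    · intro p _
      simp
    · intro p _
      simp
    · intro p _
      rfl
  rw [h1, h2]
  push_cast
  ring

lemma qPoch_succ' (x c : ℂ) (m : ℕ) : qPoch x c (m + 1) = (1 - x) * qPoch (x * c) c m := by
  unfold qPoch
  rw [Finset.prod_range_succ']
  simp only [pow_zero, one_mul]
  rw [mul_comm]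
  congr 1
  refine Finset.prod_congr rfl fun i _ => by ring

lemma qPoch_succ (x c : ℂ) (m : ℕ) : qPoch x c (m + 1) = qPoch x c m * (1 - c ^ m * x) := by
  unfold qPoch
  rw [Finset.prod_range_succ]

lemma qPoch_ne (n m : ℕ) (hm : m ≤ n) (a : ℂ) (ha1 : ∀ m : ℕ, 1 ≤ m → m ≤ n → a ^ m ≠ 1) :
    qPoch a a m ≠ 0 := by
  unfold qPoch
  rw [Finset.prod_ne_zero_iff]
  intro i hi h
  rw [Finset.mem_range] at hi
  apply ha1 (i + 1) (by omega) (by omega)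
  rw [pow_succ]
  linear_combination -h

lemma base (p : ℕ) (x₁ a : ℂ) (hx₁ : x₁ ≠ 0) (ha : a ≠ 0) (r : ℕ) : ∀ (x₂ b₂ : ℂ), x₂ ≠ 0 →
    (∀ m : ℕ, 1 ≤ m → m ≤ p + r → a ^ m ≠ 1) →
    (∀ m : ℤ, |m| ≤ ((p + r : ℕ) : ℤ) → x₂ ≠ x₁ * a ^ m) →
    GA (p + r) (WW _ 0 (fun t => 1 - b₂ * t / x₂) (fun t => 1 - t / x₁)) a⁻¹
        (xiPt (p + r) r x₁ x₂ a) =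
      (a ^ (r * p))⁻¹ * (qPoch a a (p + r) / (qPoch a a r * qPoch a a p)) *
      (qPoch b₂ a r / qPoch (x₂ / x₁ * (a ^ p)⁻¹) a r) *
      GA (p + r) (WW _ r (fun t => 1 - b₂ * t / x₂) (fun t => 1 - t / x₁)) a⁻¹
        (xiPt (p + r) r x₁ x₂ a) := by
  induction r with
  | zero =>
    intro x₂ b₂ hx₂ ha1 hgen
    have := qPoch_ne _ p (by omega) a ha1
    have e : ∀ x c, qPoch x c 0 = 1 := fun x c => by simp [qPoch]
    simp [e, this]
  | succ r ih =>
    intro x₂ b₂ hx₂ ha1 hgen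
    have IH := ih (x₂ * a) (b₂ * a) (mul_ne_zero hx₂ ha) (fun m h1 h2 => ha1 m h1 (by omega))
      (fun m hm h => hgen (m - 1) (by rw [abs_le] at *; push_cast at *; omega) (by
        rw [zpow_sub_one₀ ha, ← mul_assoc, ← h]
        field_simp))
    have ef : (fun t : ℂ => 1 - b₂ * a * t / (x₂ * a)) = (fun t : ℂ => 1 - b₂ * t / x₂) := by
      funext t
      field_simp
    rw [ef] at IH
    set f : ℂ → ℂ := (fun t : ℂ => 1 - b₂ * t / x₂) with hf
    set g : ℂ → ℂ := (fun t => 1 - t / x₁) with hg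
    have P0 := peel0 p r x₁ x₂ a hx₁ hx₂ ha f g ha1 hgen
    have P1 := peel p r r x₁ x₂ a ha f g (by simp [hg, hx₁])
    have T := tele p r x₁ x₂ a ha hx₂
    have hfx : f x₂ = 1 - b₂ := by simp [hf, hx₂]
    have hgx : g x₂ = (x₁ - x₂) / x₁ := by simp only [hg]; field_simp
    rw [IH, hfx] at P0
    rw [hgx] at P1
    have n1 : a - 1 ≠ 0 := sub_ne_zero.mpr (by simpa using ha1 1 le_rfl (by omega))
    have n2 : a ^ (r + 1) - 1 ≠ 0 := sub_ne_zero.mpr (ha1 (r + 1) (by omega) (by omega))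
    have n3 : x₁ * a ^ p - x₂ ≠ 0 := by
      have := hgen p (by rw [abs_le]; push_cast; omega)
      rw [zpow_natCast] at this
      exact sub_ne_zero.mpr this.symm
    have q1 := qPoch_ne _ p (by omega) a ha1
    have q2 := qPoch_ne _ r (by omega) a ha1
    have q4 : qPoch (x₂ / x₁ * (a ^ p)⁻¹ * a) a r ≠ 0 := by
      unfold qPoch
      rw [Finset.prod_ne_zero_iff]
      intro i hi h
      rw [Finset.mem_range] at hi
      apply hgen (p - (i + 1 : ℕ)) (by rw [abs_le]; push_cast; omega)
      rw [zpow_sub₀ ha, zpow_natCast, zpow_natCast]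
      field_simp at h ⊢
      linear_combination -h
    change GA (p + r + 1) (WW (p + r + 1) 0 f g) a⁻¹ (xiPt (p + r + 1) (r + 1) x₁ x₂ a) = _ * _ * _ *
      GA (p + r + 1) (WW (p + r + 1) (r + 1) f g) a⁻¹ (xiPt (p + r + 1) (r + 1) x₁ x₂ a)
    rw [P1]
    have n0 : (1 - a⁻¹) ≠ 0 := by
      intro h
      apply n1
      field_simp at h
      linear_combination h
    apply mul_left_cancel₀ n0
    rw [P0]
    clear P0 P1 IH
    rw [← mul_right_inj' (mul_ne_zero n2 n3)]
    generalize GA (p + r) (WW _ r f g) a⁻¹ (xiPt (p + r) r x₁ (x₂ * a) a) = Z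
    generalize (∏ i, (xiPt (p + r) r x₁ (x₂ * a) a i - x₂)) = U at *
    generalize (∏ i, (xiPt (p + r) r x₁ (x₂ * a) a i - a⁻¹ * x₂)) = V at *
    rw [show p + (r + 1) = p + r + 1 by ring, qPoch_succ a a (p + r), qPoch_succ a a r,
      qPoch_succ' b₂, qPoch_succ' (x₂ / x₁ * (a ^ p)⁻¹)]
    rw [show x₂ * a / x₁ * (a ^ p)⁻¹ = x₂ / x₁ * (a ^ p)⁻¹ * a by ring]
    generalize qPoch (x₂ / x₁ * (a ^ p)⁻¹ * a) a r = Q4 at *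
    generalize qPoch a a (p + r) = Q3
    generalize qPoch a a r = Q2 at *
    generalize qPoch a a p = Q1 at *
    generalize qPoch (b₂ * a) a r = Q5
    have d1 : 1 - x₂ / x₁ * (a ^ p)⁻¹ = (x₁ * a ^ p - x₂) / (x₁ * a ^ p) := by field_simp
    have d2 : 1 - a ^ r * a = -(a ^ (r + 1) - 1) := by ring
    have d3 : (1 - a⁻¹) = (a - 1) / a := by field_simp
    have d4 : 1 - a⁻¹ ^ (p + r + 1) = (a ^ (p + r + 1) - 1) / a ^ (p + r + 1) := by rw [inv_pow]; field_simp
    have d5 : 1 - a ^ (p + r) * a = -(a ^ (p + r + 1) - 1) := by ring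
    rw [d1, d2, d3, d4, d5, show (r + 1) * p = r * p + p by ring, pow_add a (r * p) p]
    generalize a ^ (r + 1) - 1 = R at *
    generalize x₁ * a ^ p - x₂ = S at *
    rw [pow_succ a (p + r)]
    generalize a ^ (p + r) * a - 1 = M
    have e1 : a ^ (p + r) ≠ 0 := pow_ne_zero _ ha
    generalize a ^ (p + r) = E at *
    have e2 : a ^ p ≠ 0 := pow_ne_zero _ ha
    generalize a ^ p = E2 at *
    have e3 : a ^ (r * p) ≠ 0 := pow_ne_zero _ ha
    generalize a ^ (r * p) = E3 at *
    have U' : U = E * (a - 1) * (x₁ - x₂) * V / (R * S) := by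
      rw [eq_div_iff (mul_ne_zero n2 n3), T]
    rw [U']
    field_simp

lemma main_aux (p x : ℕ) (x₁ a : ℂ) (hx₁ : x₁ ≠ 0) (ha : a ≠ 0) (s : ℕ) : ∀ (x₂ b₂ : ℂ), x₂ ≠ 0 →
    (∀ m : ℕ, 1 ≤ m → m ≤ p + (x + s) → a ^ m ≠ 1) →
    (∀ m : ℤ, |m| ≤ ((p + (x + s) : ℕ) : ℤ) → x₂ ≠ x₁ * a ^ m) →
    GA (p + (x + s)) (WW _ s (fun t => 1 - b₂ * t / x₂) (fun t => 1 - t / x₁)) a⁻¹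
        (xiPt (p + (x + s)) (x + s) x₁ x₂ a) =
      (a ^ (x * p))⁻¹ * (qPoch a a (p + x) / (qPoch a a x * qPoch a a p)) *
      (qPoch (b₂ * a ^ s) a x / qPoch (x₂ / x₁ * a ^ s * (a ^ p)⁻¹) a x) *
      GA (p + (x + s)) (WW _ (x + s) (fun t => 1 - b₂ * t / x₂) (fun t => 1 - t / x₁)) a⁻¹
        (xiPt (p + (x + s)) (x + s) x₁ x₂ a) := by
  induction s with
  | zero =>
    intro x₂ b₂ hx₂ ha1 hgen
    have := base p x₁ a hx₁ ha x x₂ b₂ hx₂ ha1 hgen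
    simpa using this
  | succ s ih =>
    intro x₂ b₂ hx₂ ha1 hgen
    have IH := ih (x₂ * a) (b₂ * a) (mul_ne_zero hx₂ ha) (fun m h1 h2 => ha1 m h1 (by omega))
      (fun m hm h => hgen (m - 1) (by rw [abs_le] at *; push_cast at *; omega) (by
        rw [zpow_sub_one₀ ha, ← mul_assoc, ← h]
        field_simp))
    have ef : (fun t : ℂ => 1 - b₂ * a * t / (x₂ * a)) = (fun t : ℂ => 1 - b₂ * t / x₂) := by
      funext t
      field_simp
    rw [ef] at IH
    set f : ℂ → ℂ := (fun t : ℂ => 1 - b₂ * t / x₂) with hf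
    set g : ℂ → ℂ := (fun t => 1 - t / x₁) with hg
    have P0 := peel p (x + s) s x₁ x₂ a ha f g (by simp [hg, hx₁])
    have P1 := peel p (x + s) (x + s) x₁ x₂ a ha f g (by simp [hg, hx₁])
    rw [IH] at P0
    refine P0.trans ?_
    refine Eq.trans ?_ (congrArg _ P1.symm)
    rw [show b₂ * a * a ^ s = b₂ * a ^ (s + 1) by ring,
      show x₂ * a / x₁ * a ^ s = x₂ / x₁ * a ^ (s + 1) by ring]
    ring

/-- The off-diagonal/diagonal ratio `c⁺_{A,rs}/c⁺_{A,rr}` of Proposition 3.1: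
`𝒜(φ_s·D_a)(ξ) = a^{−(r−s)(n−r)} · (a;a)_{n−s}/((a;a)_{r−s}(a;a)_{n−r})
  · (b₂a^s;a)_{r−s}/((x₂/x₁)a^{r+s−n};a)_{r−s} · 𝒜(φ_r·D_a)(ξ)`. -/
theorem prop3_1_ratio (n r s : ℕ) (hn : 1 ≤ n) (hsr : s ≤ r) (hr : r ≤ n)
    (x₁ x₂ a b₂ : ℂ) (hx₁ : x₁ ≠ 0) (hx₂ : x₂ ≠ 0) (ha : a ≠ 0) (hb₂ : b₂ ≠ 0)
    (ha1 : ∀ m : ℕ, 1 ≤ m → m ≤ n → a ^ m ≠ 1)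
    (hgen : ∀ m : ℤ, |m| ≤ (n : ℤ) → x₂ ≠ x₁ * a ^ m)
    (hb₂a : ∀ m : ℕ, m ≤ n → b₂ * a ^ m ≠ 1)
    (hbx : ∀ m : ℕ, m ≤ n → b₂ * x₁ * a ^ m ≠ x₂) :
    Asum n r s x₁ x₂ a b₂
    = a ^ (-(((r - s) * (n - r) : ℕ) : ℤ)) *
        (qPoch a a (n - s) / (qPoch a a (r - s) * qPoch a a (n - r))) *
        (qPoch (b₂ * a ^ s) a (r - s) /
          qPoch (x₂ / x₁ * a ^ ((r : ℤ) + (s : ℤ) - (n : ℤ))) a (r - s)) *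
        Asum n r r x₁ x₂ a b₂ := by
  obtain ⟨x, rfl⟩ : ∃ x, r = x + s := ⟨r - s, by omega⟩
  obtain ⟨p, rfl⟩ : ∃ p, n = p + (x + s) := ⟨n - (x + s), by omega⟩
  rw [Asum_eq _ _ s (by omega), Asum_eq _ _ (x + s) (by omega),
    main_aux p x x₁ a hx₁ ha s x₂ b₂ hx₂ ha1 hgen]
  have e1 : x + s - s = x := by omega
  have e2 : p + (x + s) - (x + s) = p := by omega
  have e3 : p + (x + s) - s = p + x := by omega
  have e4 : a ^ (((x + s : ℕ) : ℤ) + (s : ℤ) - ((p + (x + s) : ℕ) : ℤ)) = a ^ s * (a ^ p)⁻¹ := by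
    rw [show (((x + s : ℕ) : ℤ) + (s : ℤ) - ((p + (x + s) : ℕ) : ℤ)) = (s : ℤ) - (p : ℤ) by
      push_cast; ring, zpow_sub₀ ha, zpow_natCast, zpow_natCast, div_eq_mul_inv]
  rw [e1, e2, e3, e4, zpow_neg, zpow_natCast, ← mul_assoc (x₂ / x₁)]
  ring
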